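/- There exists a constant p > 0 such that for all sufficiently large n and all nodes x, t of a KSWN* on n nodes with Dist(x,t) ≥ (log₂ n)² · log₂ log₂ n, the probability that the AL-awareness A_x(⌈log₂ log₂ n⌉) contains a node whose K-neighbor lies within ring distance Dist(x,t)/2 of t is at least p. -/

import Mathlib

open scoped Classical BigOperators ENNReal

noncomputable section

/-- Ring (Manhattan) distance on the cycle `ZMod n`:
`Dist(u,v) = min((v-u) mod n, (u-v) mod n)`. -/
def ringDist (n : ℕ) (u v : ZMod n) : ℕ := min (v - u).val (u - v).val

/-- The harmonic normalization constant `Z_u = Σ_{z ≠ u} 1 / Dist(u,z)`. -/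
def Zconst (n : ℕ) (u : ZMod n) : ℝ :=
  ∑' z : ZMod n, if z = u then 0 else ((ringDist n u z : ℝ))⁻¹

/-- Probability that the K-link of `u` points to `v`:
`Pr[u → v] = 1 / (Z_u · Dist(u,v))` for `v ≠ u`. -/
def kProb (n : ℕ) (u v : ZMod n) : ℝ :=
  if v = u then 0 else (Zconst n u * (ringDist n u v : ℝ))⁻¹

/-- The number `⌈(log₂ n)²⌉` of candidate AL-neighbours of a node. -/
def alCount (n : ℕ) : ℕ := ⌈(Real.logb 2 n) ^ 2⌉₊

/-- Probability that a single AL-link of `u` points to `v`: the link is chosen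
uniformly among the nodes `u+1, …, u+⌈(log₂ n)²⌉` (mod n). -/
def alProb (n : ℕ) (u v : ZMod n) : ℝ :=
  if ∃ i ∈ Finset.Icc 1 (alCount n), u + (i : ZMod n) = v then ((alCount n : ℝ))⁻¹ else 0

/-- A realization of all the random links of a KSWN* on `n` nodes:
for each node its K-neighbour and its two AL-neighbours. -/
structure Config (n : ℕ) where
  K : ZMod n → ZMod n
  AL : ZMod n → Fin 2 → ZMod n

/-- Probability weight of a configuration: all links are mutually independent. -/
def configProb (n : ℕ) (c : Config n) : ℝ :=
  (∏' u : ZMod n, kProb n u (c.K u)) *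
    ∏' u : ZMod n, (alProb n u (c.AL u 0) * alProb n u (c.AL u 1))

/-- Probability of an event over the random construction of the KSWN*. -/
def Pr (n : ℕ) (E : Config n → Prop) : ℝ :=
  ∑' c : Config n, if E c then configProb n c else 0

/-- The `i`-th level `T_i` of the AL-neighbourhood of `x`. -/
def levelT (n : ℕ) (c : Config n) (x : ZMod n) : ℕ → Finset (ZMod n)
  | 0 => {x}
  | i + 1 => (levelT n c x i).biUnion fun u => {c.AL u 0, c.AL u 1}

/-- The AL-awareness `A_x(k) = H_k = ∪_{j ≤ k} T_j`. -/
def aware (n : ℕ) (c : Config n) (x : ZMod n) (k : ℕ) : Finset (ZMod n) :=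
  (Finset.range (k + 1)).biUnion (levelT n c x)

/-- `⌈log₂ log₂ n⌉`, the number of awareness levels used by the algorithms. -/
def kstar (n : ℕ) : ℕ := ⌈Real.logb 2 (Real.logb 2 n)⌉₊

/-- The distance threshold `(log₂ n)² · log₂ log₂ n`. -/
def thresh (n : ℕ) : ℝ := (Real.logb 2 n) ^ 2 * Real.logb 2 (Real.logb 2 n)

/-- Immediate neighbours of `x`: its R-neighbour, K-neighbour and two AL-neighbours. -/
def neighbors (n : ℕ) (c : Config n) (x : ZMod n) : List (ZMod n) :=
  [x + 1, c.K x, c.AL x 0, c.AL x 1]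

/-- Kleinberg greedy step: forward to the immediate neighbour closest to the target `t`. -/
def greedyNext (n : ℕ) (c : Config n) (t x : ZMod n) : ZMod n :=
  ((neighbors n c x).argmin fun y => ringDist n y t).getD x

/-- Position after `k` steps of Kleinberg's greedy routing towards `t`, started at `s`. -/
def greedyTraj (n : ℕ) (c : Config n) (t s : ZMod n) (k : ℕ) : ZMod n :=
  (greedyNext n c t)^[k] s

/-- `v` is an AL-neighbour of `u`. -/
def alStep (n : ℕ) (c : Config n) (u v : ZMod n) : Prop := c.AL u 0 = v ∨ c.AL u 1 = v

/-- `p` is a path of AL-links from `y` to `z` all of whose nodes lie in `S`. -/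
def isPath (n : ℕ) (c : Config n) (S : Finset (ZMod n)) (y z : ZMod n)
    (p : List (ZMod n)) : Prop :=
  p.head? = some y ∧ p.getLast? = some z ∧ p.Chain' (alStep n c) ∧ ∀ v ∈ p, v ∈ S

/-- A shortest AL-path from `y` to `z` inside `S` (the empty list if none exists). -/
def shortestPath (n : ℕ) (c : Config n) (S : Finset (ZMod n)) (y z : ZMod n) :
    List (ZMod n) :=
  if h : ∃ p, isPath n c S y z p ∧ ∀ q, isPath n c S y z q → p.length ≤ q.length
  then h.choose else []

/-- A node `z` in `A_y(⌈log₂ log₂ n⌉)` whose K-neighbour is closest to `t`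
(ties broken by a fixed rule). -/
def chooseZ (n : ℕ) (c : Config n) (t y : ZMod n) : ZMod n :=
  (((aware n c y (kstar n)).toList.argmin fun z => ringDist n (c.K z) t).getD y)

/-- One step of Algorithm 1 (non-oblivious routing); the state is the pair
(current node, header stack). -/
def step1 (n : ℕ) (c : Config n) (t : ZMod n) :
    ZMod n × List (ZMod n) → ZMod n × List (ZMod n) := fun st =>
  if (ringDist n st.1 t : ℝ) ≥ thresh n then
    match st.2 with
    | [] =>
      let y := c.K st.1
      let z := chooseZ n c t y
      (y, (shortestPath n c (aware n c y (kstar n)) y z).tail)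
    | v :: rest => (v, rest)
  else (greedyNext n c t st.1, [])

/-- Position after `k` hops of Algorithm 1 towards `t`, started at `s` with empty stack. -/
def traj1 (n : ℕ) (c : Config n) (t s : ZMod n) (k : ℕ) : ZMod n :=
  ((step1 n c t)^[k] (s, [])).1

/-- One step of Algorithm 2 (oblivious routing) with parameter `cp`. -/
def step2 (n : ℕ) (cp : ℝ) (c : Config n) (t x : ZMod n) : ZMod n :=
  if (ringDist n x t : ℝ) ≥ cp * thresh n then
    let S := aware n c x (kstar n)
    let cands := S.filter fun z => (ringDist n (c.K z) t : ℝ) ≤ (ringDist n x t : ℝ) / 2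
    match cands.toList.argmin fun z => (shortestPath n c S x z).length with
    | none => greedyNext n c t x
    | some z =>
      if z = x then c.K x
      else
        match shortestPath n c S x z with
        | _ :: v :: _ => v
        | _ => greedyNext n c t x
  else greedyNext n c t x

/-- Position after `k` hops of Algorithm 2 (parameter `cp`) towards `t`, started at `s`. -/
def traj2 (n : ℕ) (cp : ℝ) (c : Config n) (t s : ZMod n) (k : ℕ) : ZMod n :=
  (step2 n cp c t)^[k] s

/-- The first time `k` at which `P k` holds (`⊤` if it never does). -/
def hitTime (P : ℕ → Prop) : ℕ∞ := sInf {k : ℕ∞ | ∃ m : ℕ, P m ∧ k = m}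

/-- Expected number of hops until a trajectory first reaches the goal set,
over the random construction of the network. -/
def expHit (n : ℕ) (traj : Config n → ℕ → ZMod n) (Goal : ZMod n → Prop) : ℝ≥0∞ :=
  ∑' c : Config n,
    ENNReal.ofReal (configProb n c) * ((hitTime fun m => Goal (traj c m)) : ℝ≥0∞)

/-- Direction (±1) of the shorter arc from `x` to `t`. -/
def arcDir (n : ℕ) (x t : ZMod n) : ZMod n := if (t - x).val ≤ (x - t).val then 1 else -1

/-- The point at arc-length `i` from `x` along the shorter arc towards `t`. -/
def arcPoint (n : ℕ) (x t : ZMod n) (i : ℕ) : ZMod n := x + (i : ZMod n) * arcDir n x t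

end

/-! ### Product weights on finite function spaces -/

/-- If every coordinate in `S` hits `B` with weight at least `q`, then under the product weight
some coordinate in `S` hits `B` with weight at least `1 - (1 - q) ^ |S|`. -/
lemma one_sub_pow_le_sum_prod_of_hit {ι α : Type*} [Fintype ι] [DecidableEq ι] [Fintype α]
    [DecidableEq α] (w : ι → α → ℝ)
    (hw : ∀ i a, 0 ≤ w i a) (hw1 : ∀ i, ∑ a, w i a = 1) (S : Finset ι) (B : Finset α) (q : ℝ)
    (hq : ∀ i ∈ S, q ≤ ∑ a ∈ B, w i a) :
    1 - (1 - q) ^ S.card ≤ ∑ f : ι → α, if ∃ i ∈ S, f i ∈ B then ∏ i, w i (f i) else 0 := by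
  have total : ∑ f : ι → α, ∏ i, w i (f i) = 1 := by
    rw [← Fintype.prod_sum]; simp [hw1]
  have split : ∀ f : ι → α, ∏ i, w i (f i) =
      (if ∃ i ∈ S, f i ∈ B then ∏ i, w i (f i) else 0) +
        ∏ i, if i ∈ S ∧ f i ∈ B then 0 else w i (f i) := by
    intro f
    by_cases h : ∃ i ∈ S, f i ∈ B
    · obtain ⟨i, hi⟩ := h
      have hz : (∏ i, if i ∈ S ∧ f i ∈ B then 0 else w i (f i)) = 0 :=
        Finset.prod_eq_zero (Finset.mem_univ i) (if_pos hi)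
      rw [if_pos ⟨i, hi⟩, hz, add_zero]
    · rw [if_neg h, zero_add]
      refine Finset.prod_congr rfl fun i _ => ?_
      rw [if_neg fun hi => h ⟨i, hi⟩]
  have miss : ∑ f : ι → α, ∏ i, (if i ∈ S ∧ f i ∈ B then 0 else w i (f i)) ≤
      (1 - q) ^ S.card := by
    rw [← Fintype.prod_sum (fun i a => if i ∈ S ∧ a ∈ B then 0 else w i a)]
    calc _ ≤ ∏ i, if i ∈ S then 1 - q else 1 := by
          refine Finset.prod_le_prod (fun i _ => Finset.sum_nonneg fun a _ => ?_) fun i _ => ?_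
          · split_ifs
            exacts [le_rfl, hw i a]
          · by_cases hi : i ∈ S
            · have h := Finset.sum_add_sum_compl B (w i)
              have h' : ∑ a, (if i ∈ S ∧ a ∈ B then 0 else w i a) = ∑ a ∈ Bᶜ, w i a := by
                rw [← Finset.sum_filter_add_sum_filter_not Finset.univ (· ∈ B)]
                rw [Finset.sum_eq_zero (by simp +contextual [hi]), zero_add]
                exact Finset.sum_congr (by ext; simp) (by simp +contextual)
              rw [h', if_pos hi]
              linarith [hq i hi, hw1 i]
            · simp [hi, hw1 i]
      _ = (1 - q) ^ S.card := by simp [Finset.prod_ite_mem]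
  have key := Finset.sum_congr rfl fun (f : ι → α) (_ : f ∈ Finset.univ) => split f
  rw [total, Finset.sum_add_distrib] at key
  linarith

/-- Prescribing the values of at most `m` coordinates, each of weight `a ≤ 1`, costs at most a
factor `a ^ m`. -/
lemma pow_le_sum_prod_of_prescribed {κ α : Type*} [Fintype κ] [DecidableEq κ] [Fintype α]
    (w : κ → α → ℝ)
    (hw : ∀ i v, 0 ≤ w i v) (hw1 : ∀ i, ∑ v, w i v = 1) {m : ℕ} (e : Fin m → κ)
    (he : Function.Injective e) (y : Fin m → α) (a : ℝ) (ha : 0 ≤ a) (hy : ∀ k, a ≤ w (e k) (y k)) :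
    a ^ m ≤ ∑ f : κ → α, if ∀ k, f (e k) = y k then ∏ i, w i (f i) else 0 := by
  have expand : ∀ f : κ → α, (if ∀ k, f (e k) = y k then ∏ i, w i (f i) else 0) =
      ∏ i, if ∀ k, e k = i → f i = y k then w i (f i) else 0 := by
    intro f
    by_cases h : ∀ k, f (e k) = y k
    · rw [if_pos h]
      refine Finset.prod_congr rfl fun i _ => ?_
      rw [if_pos]
      rintro k rfl
      exact h k
    · rw [if_neg h]
      push Not at h
      obtain ⟨k, hk⟩ := h
      rw [Finset.prod_eq_zero (Finset.mem_univ (e k))]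
      exact if_neg fun h' => hk (h' k rfl)
  simp_rw [expand]
  rw [← Fintype.prod_sum (fun i v => if ∀ k, e k = i → v = y k then w i v else 0)]
  calc a ^ m = ∏ i, if i ∈ Finset.univ.image e then a else 1 := by
        simp only [Finset.prod_ite_mem, Finset.univ_inter, Finset.prod_const]
        rw [Finset.card_image_of_injective _ he, Finset.card_univ, Fintype.card_fin]
    _ ≤ _ := by
        refine Finset.prod_le_prod (fun i _ => by split_ifs <;> positivity) fun i _ => ?_
        by_cases hi : i ∈ Finset.univ.image e
        · rw [if_pos hi]
          obtain ⟨k, -, rfl⟩ := Finset.mem_image.1 hi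
          refine (hy k).trans ?_
          have := Finset.single_le_sum (f := fun v => if ∀ k', e k' = e k → v = y k'
            then w (e k) v else 0) (fun v _ => by split_ifs; exacts [hw _ _, le_rfl])
            (Finset.mem_univ (y k))
          refine le_trans (le_of_eq ?_) this
          rw [if_pos]
          intro k' hk'
          rw [he hk']
        · rw [if_neg hi]
          have h : ∀ k, e k ≠ i := fun k hk =>
            hi (Finset.mem_image.2 ⟨k, Finset.mem_univ k, hk⟩)
          simp [h, hw1 i]

/-! ### Random binary trees in heap order -/

/-- Positions of the nodes of a binary tree in heap order (the children of node `i` are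
`2 * i + 1` and `2 * i + 2`) rooted at `x`, where `o k` is the displacement along the edge
leading to node `k + 1`. -/
def heapPos {G : Type*} [AddCommGroup G] {m : ℕ} (x : G) (o : Fin m → G) : ℕ → G
  | 0 => x
  | i + 1 => heapPos x o (i / 2) + if h : i < m then o ⟨i, h⟩ else 0
decreasing_by omega

section HeapPos

variable {G : Type*} [AddCommGroup G] {m : ℕ}

lemma heapPos_zero (x : G) (o : Fin m → G) : heapPos x o 0 = x := by
  rw [heapPos]

lemma heapPos_succ (x : G) (o : Fin m → G) (k : Fin m) :
    heapPos x o (k + 1) = heapPos x o (k / 2) + o k := by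
  rw [heapPos, dif_pos k.2]

lemma heapPos_congr (x : G) {o o' : Fin m → G} {i : ℕ} (h : ∀ k : Fin m, (k : ℕ) < i → o k = o' k) :
    heapPos x o i = heapPos x o' i := by
  induction i using Nat.strong_induction_on with
  | _ i ih =>
    cases i with
    | zero => rw [heapPos_zero, heapPos_zero]
    | succ i =>
      rw [heapPos, heapPos, ih (i / 2) (by omega) fun k hk => h k (by omega)]
      split_ifs with hi
      · rw [h ⟨i, hi⟩ (Nat.lt_succ_self i)]
      · rfl

/-- The displacements are determined by the successor map along the tree edges. -/
lemma heapPos_displacement_unique (x : G) (g : G → Fin 2 → G) {o o' : Fin m → G}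
    (h : ∀ k : Fin m, g (heapPos x o (k / 2)) (Fin.ofNat 2 k) = heapPos x o (k + 1))
    (h' : ∀ k : Fin m, g (heapPos x o' (k / 2)) (Fin.ofNat 2 k) = heapPos x o' (k + 1)) :
    o = o' := by
  have pos : ∀ i ≤ m, heapPos x o i = heapPos x o' i := by
    intro i
    induction i using Nat.strong_induction_on with
    | _ i ih =>
      intro hi
      cases i with
      | zero => rw [heapPos_zero, heapPos_zero]
      | succ i =>
        have h1 := h ⟨i, hi⟩
        have h2 := h' ⟨i, hi⟩
        simp only at h1 h2
        rw [← h1, ← h2, ih (i / 2) (by omega) (by omega)]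
  funext k
  have h1 := pos (k + 1) k.2
  rw [heapPos_succ, heapPos_succ, pos (k / 2) (by omega)] at h1
  exact add_left_cancel h1

lemma card_heapPos_collision_le (x : G) (S : Finset G) {i j : ℕ} (hij : i < j) (hj : j ≤ m) :
    ((Fintype.piFinset fun _ : Fin m => S).filter
      fun o => heapPos x o i = heapPos x o j).card ≤ S.card ^ (m - 1) := by
  obtain ⟨j, rfl⟩ : ∃ j', j = j' + 1 := ⟨j - 1, by omega⟩
  let k : Fin m := ⟨j, hj⟩
  calc _ ≤ (Fintype.piFinset fun _ : {l : Fin m // l ≠ k} => S).card := by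
        refine Finset.card_le_card_of_injOn (fun o l => o l) ?_ ?_
        · intro o ho
          simp only [Finset.mem_coe, Finset.mem_filter, Fintype.mem_piFinset] at ho
          simp only [Finset.mem_coe, Fintype.mem_piFinset]
          exact fun l => ho.1 l
        · intro o ho o' ho' hoo'
          simp only [Finset.mem_coe, Finset.mem_filter] at ho ho'
          have agree : ∀ l : Fin m, l ≠ k → o l = o' l := fun l hl => congrFun hoo' ⟨l, hl⟩
          have agree' : ∀ l : Fin m, (l : ℕ) < j → o l = o' l := fun l hl =>
            agree l fun h => by simp [h, k] at hl
          have h := heapPos_succ x o k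
          have h' := heapPos_succ x o' k
          have e : o k = o' k := by
            have h1 : heapPos x o i = heapPos x o' i :=
              heapPos_congr x fun l hl => agree' l (by omega)
            have h2 : heapPos x o (j / 2) = heapPos x o' (j / 2) :=
              heapPos_congr x fun l hl => agree' l (by omega)
            have h3 : heapPos x o (j / 2) + o k = heapPos x o (j / 2) + o' k := by
              rw [← h, h2, ← h', ← ho.2, ← ho'.2, h1]
            exact add_left_cancel h3
          funext l
          by_cases hl : l = k
          · rw [hl, e]
          · exact agree l hl
    _ = S.card ^ (m - 1) := by
        rw [Fintype.card_piFinset, Finset.prod_const, Finset.card_univ]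
        simp

/-- If `|S|` is at least `2 (m + 1) ^ 2`, at least half of the displacement choices give distinct
positions. -/
lemma exists_heapPos_injOn_card_ge (x : G) (S : Finset G) (hS : 2 * (m + 1) ^ 2 ≤ S.card) :
    ∃ P : Finset (Fin m → G), (∀ o ∈ P, (∀ k, o k ∈ S) ∧
      Set.InjOn (heapPos x o) (Finset.range (m + 1))) ∧ S.card ^ m ≤ 2 * P.card := by
  refine ⟨(Fintype.piFinset fun _ : Fin m => S).filter
      fun o => Set.InjOn (heapPos x o) (Finset.range (m + 1)), fun o ho => ?_, ?_⟩
  · simpa only [Finset.mem_filter, Fintype.mem_piFinset] using ho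
  rcases Nat.eq_zero_or_pos m with rfl | hm
  · have : (Fintype.piFinset fun _ : Fin 0 => S).filter
        (fun o => Set.InjOn (heapPos x o) (Finset.range (0 + 1))) = Finset.univ := by
      ext o; simp
    rw [this]; simp
  set P := Fintype.piFinset fun _ : Fin m => S
  have hP : P.card = S.card ^ m := Fintype.card_piFinset_const S m
  have hsplit := Finset.card_filter_add_card_filter_not (s := P)
    (fun o => Set.InjOn (heapPos x o) (Finset.range (m + 1)))
  have hbad : (P.filter fun o => ¬ Set.InjOn (heapPos x o) (Finset.range (m + 1))).card ≤
      (m + 1) ^ 2 * S.card ^ (m - 1) := by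
    let pairs := (Finset.range (m + 1) ×ˢ Finset.range (m + 1)).filter fun p => p.1 < p.2
    calc _ ≤ (pairs.biUnion fun p => P.filter
              fun o => heapPos x o p.1 = heapPos x o p.2).card := by
          refine Finset.card_le_card fun o ho => ?_
          obtain ⟨hoP, hinj⟩ := Finset.mem_filter.1 ho
          simp only [Set.InjOn] at hinj
          push Not at hinj
          obtain ⟨i, hi, j, hj, hij, hne⟩ := hinj
          simp only [Finset.mem_biUnion, pairs, Finset.mem_filter, Finset.mem_product]
          rcases lt_or_gt_of_ne hne with h | h
          · exact ⟨(i, j), ⟨⟨hi, hj⟩, h⟩, hoP, hij⟩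
          · exact ⟨(j, i), ⟨⟨hj, hi⟩, h⟩, hoP, hij.symm⟩
      _ ≤ pairs.card * S.card ^ (m - 1) := by
          refine Finset.card_biUnion_le_card_mul _ _ _ fun p hp => ?_
          simp only [pairs, Finset.mem_filter, Finset.mem_product, Finset.mem_range] at hp
          exact card_heapPos_collision_le x S hp.2 (by omega)
      _ ≤ _ := by
          refine Nat.mul_le_mul_right _ ((Finset.card_filter_le _ _).trans ?_)
          simp [sq]
  have hpow : S.card ^ m = S.card * S.card ^ (m - 1) := by
    rw [← pow_succ']; congr 1; omega
  have : 2 * (m + 1) ^ 2 * S.card ^ (m - 1) ≤ S.card ^ m := by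
    rw [hpow]; exact Nat.mul_le_mul_right _ hS
  have hassoc : 2 * (m + 1) ^ 2 * S.card ^ (m - 1) = 2 * ((m + 1) ^ 2 * S.card ^ (m - 1)) := by ring
  omega

end HeapPos

/-! ### Ring distance -/

section RingDist

variable {n : ℕ}

lemma ringDist_comm (u v : ZMod n) : ringDist n u v = ringDist n v u :=
  min_comm _ _

lemma ringDist_add_natCast_le (u : ZMod n) (i : ℕ) : ringDist n u (u + i) ≤ i := by
  refine (min_le_left _ _).trans ?_
  rw [add_sub_cancel_left, ZMod.val_natCast]
  exact Nat.mod_le _ _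

lemma ringDist_pos {u v : ZMod n} (h : v ≠ u) : 0 < ringDist n u v := by
  rw [ringDist, lt_min_iff]
  exact ⟨ZMod.val_pos.2 (sub_ne_zero.2 h), ZMod.val_pos.2 (sub_ne_zero.2 h.symm)⟩

variable [NeZero n]

lemma ringDist_eq_natAbs (u v : ZMod n) : ringDist n u v = (v - u).valMinAbs.natAbs := by
  rw [ZMod.valMinAbs_natAbs_eq_min, ringDist, ← neg_sub v u, ZMod.neg_val]
  split_ifs with h
  · simp [h]
  · rfl

lemma ringDist_triangle (u v w : ZMod n) :
    ringDist n u w ≤ ringDist n u v + ringDist n v w := by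
  simp only [ringDist_eq_natAbs]
  have h := ZMod.natAbs_valMinAbs_add_le (v - u) (w - v)
  have h' := Int.natAbs_add_le (v - u).valMinAbs (w - v).valMinAbs
  rw [show v - u + (w - v) = w - u by abel] at h
  exact h.trans h'

lemma ringDist_le_half (u v : ZMod n) : ringDist n u v ≤ n / 2 := by
  rw [ringDist_eq_natAbs]
  exact ZMod.natAbs_valMinAbs_le _

end RingDist

/-! ### Long-range links -/

section KLink

variable {n : ℕ} [NeZero n]

lemma Zconst_eq_sum (u : ZMod n) :
    Zconst n u = ∑ z : ZMod n, if z = u then 0 else ((ringDist n u z : ℝ))⁻¹ :=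
  tsum_fintype _

lemma Zconst_pos (hn : 2 ≤ n) (u : ZMod n) : 0 < Zconst n u := by
  have : Fact (1 < n) := ⟨hn⟩
  rw [Zconst_eq_sum]
  have hne : u + 1 ≠ u := by simp
  refine Finset.sum_pos' (fun z _ => by split_ifs <;> positivity) ⟨u + 1, Finset.mem_univ _, ?_⟩
  rw [if_neg hne]
  have := ringDist_pos hne
  positivity

lemma sum_zmod_inv_val_le : ∑ z : ZMod n, ((z.val : ℝ))⁻¹ ≤ 1 + Real.log n := by
  calc ∑ z : ZMod n, ((z.val : ℝ))⁻¹
      = ∑ i ∈ Finset.univ.image (ZMod.val (n := n)), ((i : ℝ))⁻¹ := by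
        rw [Finset.sum_image (fun a _ b _ h => ZMod.val_injective n h)]
    _ ≤ ∑ i ∈ Finset.range (n + 1), ((i : ℝ))⁻¹ := by
        refine Finset.sum_le_sum_of_subset_of_nonneg ?_ fun _ _ _ => by positivity
        intro i hi
        obtain ⟨z, -, rfl⟩ := Finset.mem_image.1 hi
        exact Finset.mem_range.2 ((ZMod.val_lt z).trans (Nat.lt_succ_self n))
    _ = harmonic n := by
        rw [Finset.sum_range_succ', harmonic]
        push_cast
        simp
    _ ≤ _ := harmonic_le_one_add_log n

lemma Zconst_le (u : ZMod n) : Zconst n u ≤ 2 * (1 + Real.log n) := by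
  rw [Zconst_eq_sum]
  calc _ ≤ ∑ z : ZMod n, ((((z - u).val : ℝ))⁻¹ + (((u - z).val : ℝ))⁻¹) := by
        refine Finset.sum_le_sum fun z _ => ?_
        have h1 : (0 : ℝ) ≤ (((z - u).val : ℝ))⁻¹ := by positivity
        have h2 : (0 : ℝ) ≤ (((u - z).val : ℝ))⁻¹ := by positivity
        split_ifs
        · positivity
        · rw [ringDist]
          rcases min_choice (z - u).val (u - z).val with h | h <;> rw [h] <;> linarith
    _ = ∑ z : ZMod n, ((z.val : ℝ))⁻¹ + ∑ z : ZMod n, ((z.val : ℝ))⁻¹ := by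
        rw [Finset.sum_add_distrib]
        congr 1
        · exact (Equiv.subRight u).sum_comp fun z : ZMod n => ((z.val : ℝ))⁻¹
        · exact (Equiv.subLeft u).sum_comp fun z : ZMod n => ((z.val : ℝ))⁻¹
    _ ≤ _ := by linarith [sum_zmod_inv_val_le (n := n)]

lemma kProb_nonneg (u v : ZMod n) : 0 ≤ kProb n u v := by
  have : 0 ≤ Zconst n u := by
    rw [Zconst_eq_sum]
    exact Finset.sum_nonneg fun z _ => by split_ifs <;> positivity
  rw [kProb]
  split_ifs <;> positivity

lemma sum_kProb (hn : 2 ≤ n) (u : ZMod n) : ∑ v, kProb n u v = 1 := by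
  have h : ∀ v, kProb n u v =
      (Zconst n u)⁻¹ * if v = u then 0 else ((ringDist n u v : ℝ))⁻¹ := by
    intro v
    rw [kProb]
    split_ifs <;> simp [mul_comm]
  simp_rw [h]
  rw [← Finset.mul_sum, ← Zconst_eq_sum, inv_mul_cancel₀ (Zconst_pos hn u).ne']

/-- A node within distance `2 d` of `t` has its K-link land within distance `d / 2` of `t` with
probability of order at least `1 / log n`. -/
lemma le_sum_kProb_ball (hn : 2 ≤ n) (t u : ZMod n) {d : ℕ} (hd : 2 ≤ d) (hdn : d ≤ n / 2)
    (hu : ringDist n u t ≤ 2 * d) :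
    (18 * (1 + Real.log n))⁻¹ ≤
      ∑ v ∈ Finset.univ.filter (fun v => ringDist n v t ≤ d / 2), kProb n u v := by
  set B := Finset.univ.filter fun v : ZMod n => ringDist n v t ≤ d / 2
  have hZ := Zconst_pos hn u
  have hcard : d / 2 + 1 ≤ B.card := by
    have hinj : Set.InjOn (fun i : ℕ => t + (i : ZMod n)) (Finset.range (d / 2 + 1)) := by
      intro i hi j hj hij
      simp only [Finset.coe_range, Set.mem_Iio] at hi hj
      have h := congrArg ZMod.val (add_left_cancel hij)
      rwa [ZMod.val_natCast_of_lt (by omega), ZMod.val_natCast_of_lt (by omega)] at h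
    rw [← Finset.card_range (d / 2 + 1), ← Finset.card_image_of_injOn hinj]
    refine Finset.card_le_card fun v hv => ?_
    obtain ⟨i, hi, rfl⟩ := Finset.mem_image.1 hv
    rw [Finset.mem_range] at hi
    refine Finset.mem_filter.2 ⟨Finset.mem_univ _, ?_⟩
    rw [ringDist_comm]
    exact (ringDist_add_natCast_le t i).trans (by omega)
  have hcard' : d / 2 ≤ (B.erase u).card := by
    have := Finset.pred_card_le_card_erase (s := B) (a := u)
    omega
  have hterm : ∀ v ∈ B.erase u, (Zconst n u * (3 * d))⁻¹ ≤ kProb n u v := by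
    intro v hv
    obtain ⟨hvu, hvB⟩ := Finset.mem_erase.1 hv
    have hvt := (Finset.mem_filter.1 hvB).2
    have hdist : ringDist n u v ≤ 3 * d := by
      have := ringDist_triangle u t v
      rw [ringDist_comm t v] at this
      omega
    have hpos := ringDist_pos hvu
    rw [kProb, if_neg hvu]
    have : (ringDist n u v : ℝ) ≤ 3 * d := by exact_mod_cast hdist
    gcongr
  have hd3 : (d : ℝ) ≤ 3 * (d / 2 : ℕ) := by
    have : d ≤ 3 * (d / 2) := by omega
    exact_mod_cast this
  have hdpos : (0 : ℝ) < d := by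
    have : 0 < d := by omega
    exact_mod_cast this
  calc (18 * (1 + Real.log n))⁻¹ ≤ (9 * Zconst n u)⁻¹ := by
        have := Zconst_le u
        exact inv_anti₀ (by positivity) (by linarith)
    _ = (d / 3) * (Zconst n u * (3 * d))⁻¹ := by field_simp; norm_num
    _ ≤ (B.erase u).card * (Zconst n u * (3 * d))⁻¹ := by
        have : ((d / 2 : ℕ) : ℝ) ≤ (B.erase u).card := by exact_mod_cast hcard'
        gcongr
        linarith
    _ ≤ ∑ v ∈ B.erase u, kProb n u v := by
        rw [← nsmul_eq_mul]
        exact Finset.card_nsmul_le_sum _ _ _ hterm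
    _ ≤ _ := Finset.sum_le_sum_of_subset_of_nonneg (Finset.erase_subset _ _)
        fun v _ _ => kProb_nonneg u v

end KLink

/-! ### Augmented local links -/

/-- The possible displacements along an AL-link. -/
noncomputable def alOffsets (n : ℕ) : Finset (ZMod n) :=
  (Finset.Icc 1 (alCount n)).image fun i : ℕ => (i : ZMod n)

section ALLink

variable {n : ℕ}

lemma alProb_nonneg (u v : ZMod n) : 0 ≤ alProb n u v := by
  rw [alProb]
  split_ifs <;> positivity

lemma alProb_eq (u v : ZMod n) :
    alProb n u v = if v - u ∈ alOffsets n then ((alCount n : ℝ))⁻¹ else 0 := by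
  have h : (∃ i ∈ Finset.Icc 1 (alCount n), u + (i : ZMod n) = v) ↔ v - u ∈ alOffsets n := by
    simp only [alOffsets, Finset.mem_image, eq_sub_iff_add_eq']
  rw [alProb]
  by_cases hv : v - u ∈ alOffsets n
  · rw [if_pos hv, if_pos (h.2 hv)]
  · rw [if_neg hv, if_neg (mt h.1 hv)]

lemma card_alOffsets (h : alCount n ≤ n) : (alOffsets n).card = alCount n := by
  rw [alOffsets, Finset.card_image_of_injOn, Nat.card_Icc, Nat.add_sub_cancel]
  intro i hi j hj hij
  simp only [Finset.coe_Icc, Set.mem_Icc] at hi hj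
  have h' : i ≡ j [MOD n] := (ZMod.natCast_eq_natCast_iff _ _ _).1 hij
  rcases le_total i j with hle | hle
  · obtain ⟨c, hc⟩ := (Nat.modEq_iff_dvd' hle).1 h'
    rcases Nat.eq_zero_or_pos c with rfl | hc'
    · omega
    · have := Nat.le_mul_of_pos_right n hc'
      omega
  · obtain ⟨c, hc⟩ := (Nat.modEq_iff_dvd' hle).1 h'.symm
    rcases Nat.eq_zero_or_pos c with rfl | hc'
    · omega
    · have := Nat.le_mul_of_pos_right n hc'
      omega

/-- Node `i` of a tree embedded along AL-links lies in a level `j` with `2 ^ j ≤ i + 1`. -/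
lemma exists_heapPos_mem_levelT (c : Config n) {m : ℕ} (x : ZMod n) (o : Fin m → ZMod n)
    (hc : ∀ k : Fin m, c.AL (heapPos x o (k / 2)) (Fin.ofNat 2 k) = heapPos x o (k + 1))
    {i : ℕ} (hi : i ≤ m) :
    ∃ j, 2 ^ j ≤ i + 1 ∧ heapPos x o i ∈ levelT n c x j := by
  induction i using Nat.strong_induction_on with
  | _ i ih =>
    cases i with
    | zero => exact ⟨0, by simp, by simp [heapPos_zero, levelT]⟩
    | succ i =>
      obtain ⟨j, hj, hmem⟩ := ih (i / 2) (by omega) (by omega)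
      refine ⟨j + 1, by rw [pow_succ]; omega, ?_⟩
      have h := hc ⟨i, hi⟩
      simp only at h
      rw [levelT, Finset.mem_biUnion]
      refine ⟨_, hmem, ?_⟩
      rw [← h, Finset.mem_insert, Finset.mem_singleton]
      rcases Nat.mod_two_eq_zero_or_one i with h2 | h2
      · left; congr 1; ext; simp [h2]
      · right; congr 1; ext; simp [h2]

lemma ringDist_add_alOffset_le (u : ZMod n) {s : ZMod n} (hs : s ∈ alOffsets n) :
    ringDist n u (u + s) ≤ alCount n := by
  obtain ⟨i, hi, rfl⟩ := Finset.mem_image.1 hs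
  exact (ringDist_add_natCast_le u i).trans (Finset.mem_Icc.1 hi).2

variable [NeZero n]

lemma sum_alProb (h0 : 0 < alCount n) (h : alCount n ≤ n) (u : ZMod n) :
    ∑ v, alProb n u v = 1 := by
  simp_rw [alProb_eq]
  refine (Fintype.sum_equiv (Equiv.subRight u) _
    (fun z : ZMod n => if z ∈ alOffsets n then ((alCount n : ℝ))⁻¹ else 0) fun _ => rfl).trans ?_
  rw [Finset.sum_ite_mem, Finset.univ_inter, Finset.sum_const, card_alOffsets h, nsmul_eq_mul]
  have : (alCount n : ℝ) ≠ 0 := by positivity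
  field_simp

lemma exists_ringDist_heapPos_le {m : ℕ} (x : ZMod n) (o : Fin m → ZMod n)
    (ho : ∀ k, o k ∈ alOffsets n) {i : ℕ} (hi : i ≤ m) :
    ∃ j, 2 ^ j ≤ i + 1 ∧ ringDist n x (heapPos x o i) ≤ j * alCount n := by
  induction i using Nat.strong_induction_on with
  | _ i ih =>
    cases i with
    | zero => exact ⟨0, by simp, by simp [heapPos_zero, ringDist]⟩
    | succ i =>
      obtain ⟨j, hj, hdist⟩ := ih (i / 2) (by omega) (by omega)
      refine ⟨j + 1, by rw [pow_succ]; omega, ?_⟩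
      have h := heapPos_succ x o ⟨i, hi⟩
      simp only at h
      have h1 := ringDist_triangle x (heapPos x o (i / 2)) (heapPos x o (i + 1))
      have h2 := ringDist_add_alOffset_le (heapPos x o (i / 2)) (ho ⟨i, hi⟩)
      rw [← h] at h2
      rw [add_mul, one_mul]
      omega

/-- Any fixed tree embedding with distinct nodes is followed by the AL-links with probability at
least `|A|⁻¹` per edge. -/
lemma pow_le_sum_prod_alProb (h0 : 0 < alCount n) (h : alCount n ≤ n) {m : ℕ} (x : ZMod n)
    (o : Fin m → ZMod n) (ho : ∀ k, o k ∈ alOffsets n)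
    (hinj : Set.InjOn (heapPos x o) (Finset.range (m + 1))) :
    ((alCount n : ℝ)⁻¹) ^ m ≤ ∑ g : ZMod n → Fin 2 → ZMod n,
      if ∀ k : Fin m, g (heapPos x o (k / 2)) (Fin.ofNat 2 k) = heapPos x o (k + 1) then
        ∏ u, (alProb n u (g u 0) * alProb n u (g u 1)) else 0 := by
  let e : Fin m → ZMod n × Fin 2 := fun k => (heapPos x o (k / 2), Fin.ofNat 2 k)
  have he : Function.Injective e := by
    intro k l hkl
    simp only [e, Prod.mk.injEq] at hkl
    have h1 := hinj (by simp; omega) (by simp; omega) hkl.1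
    have h2 := congrArg Fin.val hkl.2
    simp only [Fin.val_ofNat] at h2
    ext
    omega
  have key := pow_le_sum_prod_of_prescribed (fun p : ZMod n × Fin 2 => alProb n p.1)
    (fun p v => alProb_nonneg p.1 v) (fun p => sum_alProb h0 h p.1) e he
    (fun k => heapPos x o (k + 1)) ((alCount n : ℝ)⁻¹) (by positivity) (by
      intro k
      rw [alProb_eq, heapPos_succ, add_sub_cancel_left, if_pos (ho k)])
  refine key.trans (le_of_eq ?_)
  apply Fintype.sum_equiv (Equiv.curry (ZMod n) (Fin 2) (ZMod n))
  intro f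
  simp [e, Fintype.prod_prod_type]

end ALLink

/-! ### The random network -/

/-- A configuration is a choice of long-range links together with a choice of local links. -/
def configEquiv (n : ℕ) : Config n ≃ (ZMod n → Fin 2 → ZMod n) × (ZMod n → ZMod n) where
  toFun c := (c.AL, c.K)
  invFun p := ⟨p.2, p.1⟩

section Network

variable {n : ℕ} [NeZero n]

lemma Pr_eq_sum (E : Config n → Prop) :
    Pr n E = ∑ g : ZMod n → Fin 2 → ZMod n, (∏ u, (alProb n u (g u 0) * alProb n u (g u 1))) *
      ∑ f : ZMod n → ZMod n, if E ⟨f, g⟩ then ∏ u, kProb n u (f u) else 0 := by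
  rw [Pr, ← (configEquiv n).symm.tsum_eq, tsum_fintype, Fintype.sum_prod_type]
  refine Finset.sum_congr rfl fun g _ => ?_
  rw [Finset.mul_sum]
  refine Finset.sum_congr rfl fun f _ => ?_
  simp only [configEquiv, Equiv.coe_fn_symm_mk, configProb, tprod_fintype]
  rw [mul_ite, mul_zero, mul_comm]

/-- If `κ` bounds from below the conditional probability of `E` given any local links following
some tree embedding with distinct nodes, then `E` has probability at least `κ / 2`. -/
lemma half_le_Pr_of_tree (h : alCount n ≤ n) {m : ℕ} (hm : 2 * (m + 1) ^ 2 ≤ alCount n)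
    (x : ZMod n) (E : Config n → Prop) {κ : ℝ} (hκ : 0 ≤ κ)
    (hE : ∀ (g : ZMod n → Fin 2 → ZMod n) (o : Fin m → ZMod n), (∀ k, o k ∈ alOffsets n) →
      Set.InjOn (heapPos x o) (Finset.range (m + 1)) →
      (∀ k : Fin m, g (heapPos x o (k / 2)) (Fin.ofNat 2 k) = heapPos x o (k + 1)) →
      κ ≤ ∑ f : ZMod n → ZMod n, if E ⟨f, g⟩ then ∏ u, kProb n u (f u) else 0) :
    κ / 2 ≤ Pr n E := by
  have h0 : 0 < alCount n := lt_of_lt_of_le (by positivity) hm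
  obtain ⟨P, hP, hcardP⟩ := exists_heapPos_injOn_card_ge (m := m) x (alOffsets n)
    (by rwa [card_alOffsets h])
  let F : (ZMod n → Fin 2 → ZMod n) → (Fin m → ZMod n) → Prop := fun g o =>
    ∀ k : Fin m, g (heapPos x o (k / 2)) (Fin.ofNat 2 k) = heapPos x o (k + 1)
  let W : (ZMod n → Fin 2 → ZMod n) → ℝ := fun g =>
    ∏ u, (alProb n u (g u 0) * alProb n u (g u 1))
  have hW : ∀ g, 0 ≤ W g := fun g =>
    Finset.prod_nonneg fun u _ => mul_nonneg (alProb_nonneg _ _) (alProb_nonneg _ _)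
  have hcard : ((alCount n : ℝ)) ^ m ≤ 2 * P.card := by
    rw [card_alOffsets h] at hcardP
    exact_mod_cast hcardP
  have hfollow : ∀ g, (∑ o ∈ P, if F g o then κ else 0) ≤
      ∑ f : ZMod n → ZMod n, if E ⟨f, g⟩ then ∏ u, kProb n u (f u) else 0 := by
    intro g
    by_cases hex : ∃ o ∈ P, F g o
    · obtain ⟨o, ho, hgo⟩ := hex
      rw [Finset.sum_eq_single_of_mem o ho, if_pos hgo]
      · exact hE g o (hP o ho).1 (hP o ho).2 hgo
      · intro o' _ hne
        exact if_neg fun hgo' => hne (heapPos_displacement_unique x g hgo' hgo)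
    · rw [Finset.sum_eq_zero fun o ho => if_neg fun hgo => hex ⟨o, ho, hgo⟩]
      refine Finset.sum_nonneg fun f _ => ?_
      split_ifs
      exacts [Finset.prod_nonneg fun u _ => kProb_nonneg _ _, le_rfl]
  calc κ / 2 ≤ ∑ o ∈ P, ((alCount n : ℝ)⁻¹) ^ m * κ := by
        rw [Finset.sum_const, nsmul_eq_mul, inv_pow]
        have : (0 : ℝ) < (alCount n : ℝ) ^ m := by positivity
        rw [← mul_assoc, ← div_eq_mul_inv, mul_comm, div_eq_inv_mul, mul_comm κ]
        rw [mul_comm _ κ, mul_comm _ κ]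
        refine mul_le_mul_of_nonneg_left ?_ hκ
        rw [le_div_iff₀ this]
        linarith
    _ ≤ ∑ o ∈ P, (∑ g, if F g o then W g else 0) * κ := by
        refine Finset.sum_le_sum fun o ho => mul_le_mul_of_nonneg_right ?_ hκ
        exact pow_le_sum_prod_alProb h0 h x o (hP o ho).1 (hP o ho).2
    _ = ∑ g, W g * ∑ o ∈ P, if F g o then κ else 0 := by
        simp_rw [Finset.sum_mul, Finset.mul_sum]
        rw [Finset.sum_comm]
        refine Finset.sum_congr rfl fun g _ => Finset.sum_congr rfl fun o _ => ?_
        split_ifs <;> simp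
    _ ≤ _ := by
        rw [Pr_eq_sum]
        exact Finset.sum_le_sum fun g _ => mul_le_mul_of_nonneg_left (hfollow g) (hW g)

/-- The halving bound for a tree with `m + 1` nodes, under explicit size conditions. -/
lemma le_Pr_halving (hn : 2 ≤ n) (h : alCount n ≤ n) {m k d : ℕ}
    (hm : 2 * (m + 1) ^ 2 ≤ alCount n) (hmk : m + 1 ≤ 2 ^ k) (x t : ZMod n)
    (hd : ringDist n x t = d) (hd2 : 2 ≤ d)
    (hmd : ∀ j : ℕ, 2 ^ j ≤ m + 1 → j * alCount n ≤ d) :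
    (1 - Real.exp (-((m + 1) / (18 * (1 + Real.log n))))) / 2 ≤
      Pr n (fun c => ∃ z ∈ aware n c x k,
        (ringDist n (c.K z) t : ℝ) ≤ (ringDist n x t : ℝ) / 2) := by
  set q : ℝ := (18 * (1 + Real.log n))⁻¹
  have hlog : 0 ≤ Real.log n := Real.log_natCast_nonneg n
  have hq0 : 0 ≤ q := by positivity
  have hq1 : q ≤ 1 := inv_le_one_of_one_le₀ (by linarith)
  refine half_le_Pr_of_tree h hm x _ ?_ ?_
  · have : Real.exp (-((m + 1) / (18 * (1 + Real.log n)))) ≤ 1 :=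
      Real.exp_le_one_iff.2 (by rw [neg_nonpos]; positivity)
    linarith
  intro g o ho hinj hgo
  set S := (Finset.range (m + 1)).image (heapPos x o)
  set B := Finset.univ.filter fun v : ZMod n => ringDist n v t ≤ d / 2
  have hS : S.card = m + 1 := by
    rw [Finset.card_image_of_injOn hinj, Finset.card_range]
  have hqS : ∀ u ∈ S, q ≤ ∑ v ∈ B, kProb n u v := by
    intro u hu
    obtain ⟨i, hi, rfl⟩ := Finset.mem_image.1 hu
    rw [Finset.mem_range] at hi
    obtain ⟨j, hj, hdist⟩ := exists_ringDist_heapPos_le x o ho (Nat.lt_succ_iff.1 hi)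
    have hjd := hmd j (hj.trans hi)
    refine le_sum_kProb_ball hn t _ hd2 (hd ▸ ringDist_le_half x t) ?_
    have := ringDist_triangle (heapPos x o i) x t
    rw [ringDist_comm _ x] at this
    omega
  have hit := one_sub_pow_le_sum_prod_of_hit (kProb n) kProb_nonneg (sum_kProb hn) S B q hqS
  refine le_trans ?_ (hit.trans (Finset.sum_le_sum fun f _ => ?_))
  · have : (1 - q) ^ (m + 1) ≤ Real.exp (-q) ^ (m + 1) :=
      pow_le_pow_left₀ (by linarith) (Real.one_sub_le_exp_neg q) _
    rw [← Real.exp_nat_mul] at this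
    rw [hS, div_eq_mul_inv]
    push_cast at this
    rw [mul_neg] at this
    linarith
  · by_cases hex : ∃ u ∈ S, f u ∈ B
    · rw [if_pos hex, if_pos]
      obtain ⟨u, hu, hfu⟩ := hex
      obtain ⟨i, hi, rfl⟩ := Finset.mem_image.1 hu
      rw [Finset.mem_range] at hi
      obtain ⟨j, hj, hmem⟩ := exists_heapPos_mem_levelT ⟨f, g⟩ x o hgo (Nat.lt_succ_iff.1 hi)
      have hjk : j ≤ k :=
        (Nat.pow_le_pow_iff_right one_lt_two).1 (hj.trans ((Nat.succ_le_of_lt hi).trans hmk))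
      refine ⟨_, Finset.mem_biUnion.2 ⟨j, Finset.mem_range.2 (by omega), hmem⟩, ?_⟩
      have hball := (Finset.mem_filter.1 hfu).2
      rw [hd]
      have : ((d / 2 : ℕ) : ℝ) ≤ (d : ℝ) / 2 := Nat.cast_div_le
      exact (Nat.cast_le.2 hball).trans this
    · rw [if_neg hex]
      split_ifs
      exacts [Finset.prod_nonneg fun u _ => kProb_nonneg _ _, le_rfl]

end Network

/-! ### Asymptotics -/

lemma eventually_alCount_le : ∀ᶠ n : ℕ in Filter.atTop, alCount n ≤ n := by
  have h := (Real.isLittleO_pow_log_id_atTop (n := 2)).bound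
    (show (0 : ℝ) < Real.log 2 ^ 2 by positivity)
  filter_upwards [tendsto_natCast_atTop_atTop.eventually h] with n hn
  rw [alCount, Nat.ceil_le, Real.logb, div_pow, div_le_iff₀ (by positivity)]
  have := (le_abs_self _).trans hn
  simpa [mul_comm] using this

lemma eventually_four_le_logb : ∀ᶠ n : ℕ in Filter.atTop, 4 ≤ Real.logb 2 n :=
  ((Real.tendsto_logb_atTop one_lt_two).comp tendsto_natCast_atTop_atTop).eventually_ge_atTop 4

/-- There is a constant `p > 0` such that for all sufficiently large `n` and
nodes `x, t` with `Dist(x,t) ≥ (log₂ n)²·log₂ log₂ n`, with probability at least `p` the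
awareness `A_x(⌈log₂ log₂ n⌉)` contains a node whose K-neighbour is within `Dist(x,t)/2` of `t`. -/
theorem awareness_contains_halving_kLink :
    ∃ p : ℝ, 0 < p ∧ ∃ N : ℕ, ∀ n : ℕ, N ≤ n → ∀ x t : ZMod n,
      thresh n ≤ (ringDist n x t : ℝ) →
      p ≤ Pr n (fun c => ∃ z ∈ aware n c x (kstar n),
            (ringDist n (c.K z) t : ℝ) ≤ (ringDist n x t : ℝ) / 2) := by
  refine ⟨(1 - Real.exp (-(1 / 144))) / 2, ?_, ?_⟩
  · have : Real.exp (-(1 / 144)) < 1 := Real.exp_lt_one_iff.2 (by norm_num)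
    linarith
  obtain ⟨N, hN⟩ := Filter.eventually_atTop.1
    (eventually_alCount_le.and (eventually_four_le_logb.and (Filter.eventually_ge_atTop 2)))
  refine ⟨N, fun n hn x t hdist => ?_⟩
  obtain ⟨hA, hL, hn2⟩ := hN n hn
  have : NeZero n := ⟨by omega⟩
  set L := Real.logb 2 n with hLdef
  have hlogL : Real.log n ≤ L := by
    rw [hLdef, Real.logb, le_div_iff₀ (Real.log_pos one_lt_two)]
    have h1 : Real.log 2 ≤ 1 := by linarith [Real.log_two_lt_d9]
    exact mul_le_of_le_one_right (Real.log_natCast_nonneg n) h1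
  have hlog0 : 0 ≤ Real.log n := Real.log_natCast_nonneg n
  have hloglog : 2 ≤ Real.logb 2 L := by
    rw [Real.le_logb_iff_rpow_le one_lt_two (by linarith)]
    norm_num
    exact hL
  have hloglog_le : Real.logb 2 L ≤ L ^ 2 := by
    have h1 := Real.log_le_sub_one_of_pos (show 0 < L by linarith)
    have h2 : 1 / 2 ≤ Real.log 2 := by linarith [Real.log_two_gt_d9]
    rw [Real.logb, div_le_iff₀ (by linarith)]
    nlinarith [sq_nonneg (L - 1), sq_nonneg L]
  obtain ⟨m, hm⟩ : ∃ m, ⌊L / 2⌋₊ = m + 1 := by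
    have : 1 ≤ ⌊L / 2⌋₊ := Nat.le_floor (by push_cast; linarith)
    exact ⟨⌊L / 2⌋₊ - 1, by omega⟩
  have hm_le : (m : ℝ) + 1 ≤ L / 2 := by
    have := Nat.floor_le (show 0 ≤ L / 2 by linarith)
    rw [hm] at this
    exact_mod_cast this
  have hm_ge : L / 4 ≤ (m : ℝ) + 1 := by
    have := Nat.lt_floor_add_one (L / 2)
    rw [hm] at this
    push_cast at this
    linarith
  have hA_ge : L ^ 2 ≤ alCount n := Nat.le_ceil _
  have hA_le : (alCount n : ℝ) < L ^ 2 + 1 := Nat.ceil_lt_add_one (by positivity)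
  have hthresh : L ^ 2 * Real.logb 2 L ≤ ringDist n x t := hdist
  refine le_trans ?_ (le_Pr_halving hn2 hA (m := m) (k := kstar n) ?_ ?_ x t rfl ?_ ?_)
  · have : (1 : ℝ) / 144 ≤ (m + 1) / (18 * (1 + Real.log n)) := by
      rw [div_le_div_iff₀ (by norm_num) (by positivity)]
      linarith
    gcongr
  · have : (2 : ℝ) * (m + 1) ^ 2 ≤ alCount n := by nlinarith
    exact_mod_cast this
  · have h1 : Real.logb 2 L ≤ kstar n := Nat.le_ceil _
    rw [Real.logb_le_iff_le_rpow one_lt_two (by linarith), Real.rpow_natCast] at h1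
    have : (m : ℝ) + 1 ≤ 2 ^ kstar n := by linarith
    exact_mod_cast this
  · have : (2 : ℝ) ≤ ringDist n x t := by nlinarith
    exact_mod_cast this
  · intro j hj
    have hj' : (2 : ℝ) ^ (j + 1) ≤ L := by
      have : (2 : ℝ) ^ j ≤ m + 1 := by exact_mod_cast hj
      rw [pow_succ]
      linarith
    have hj2 : (j : ℝ) + 1 ≤ Real.logb 2 L := by
      rw [Real.le_logb_iff_rpow_le one_lt_two (by linarith)]
      exact_mod_cast hj'
    have : (j : ℝ) * alCount n ≤ ringDist n x t := by
      calc (j : ℝ) * alCount n ≤ (Real.logb 2 L - 1) * (L ^ 2 + 1) := by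
            exact mul_le_mul (by linarith) hA_le.le (by positivity) (by linarith)
        _ ≤ L ^ 2 * Real.logb 2 L := by linarith
        _ ≤ _ := hthresh
    exact_mod_cast this
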